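/- arXiv:2006.07947 — 2 statements merged into one kernel-verified Lean document; each statement's English description precedes it below -/
import Mathlib

section
/- Let W be a 2-dimensional Coxeter group. Let f ∈ W with T(f) = {s, t} for distinct s, t ∈ S (so that m_st < ∞), let h = Π(f), and let R = f⟨s,t⟩ be the {s,t}-residue containing f and h. Let g ∈ R, let m = ℓ(h⁻¹g), and suppose T(g) = {s, r} for some r ∈ S with r ∉ {s, t}. If m_st = 3 and m = 2, then m_sr = 2. -/
namespace CoxeterPaper

open CoxeterSystem

attribute [local instance] Classical.propDecidable

variable {B : Type} [DecidableEq B] [Fintype B]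
variable {W : Type} [Group W] {M : CoxeterMatrix B}

/-- The right descent set `T(g) = {s ∈ S : ℓ(gs) < ℓ(g)}`, as a set of indices. -/
def descentSet (cs : CoxeterSystem M W) (g : W) : Set B :=
  {i | cs.IsRightDescent g i}

/-- The subgroup `⟨T(g)⟩` generated by the right descent set of `g`. -/
def descSubgroup (cs : CoxeterSystem M W) (g : W) : Subgroup W :=
  Subgroup.closure (cs.simple '' descentSet cs g)

/-- `w(g)`: the longest element of `⟨T(g)⟩` (defined via choice; for `g ≠ 1` the
subgroup `⟨T(g)⟩` is finite and has a unique longest element). -/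
noncomputable def wg (cs : CoxeterSystem M W) (g : W) : W :=
  if h : ∃ w₀ ∈ descSubgroup cs g, ∀ u ∈ descSubgroup cs g, cs.length u ≤ cs.length w₀
  then h.choose else 1

/-- `Π(g) = g · w(g)`. -/
noncomputable def PiMap (cs : CoxeterSystem M W) (g : W) : W := g * wg cs g

/-- The standard language `𝓛 ⊆ S*`: the empty word is in `𝓛` (and it is the only word of `𝓛`
representing the identity); a word `v` of length `n` representing `g ≠ 1` is in `𝓛` iff,
setting `k = ℓ(w(g))`, the prefix `v(n-k)` is in `𝓛` and `v(n-k+1, n)` represents `w(g)`. -/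
inductive StdLang (cs : CoxeterSystem M W) : List B → Prop
  | nil : StdLang cs []
  | step (v : List B) (hne : cs.wordProd v ≠ 1)
      (hpre : StdLang cs (v.take (v.length - cs.length (wg cs (cs.wordProd v)))))
      (hsuf : cs.wordProd (v.drop (v.length - cs.length (wg cs (cs.wordProd v))))
        = wg cs (cs.wordProd v)) : StdLang cs v

/-- A Coxeter group is 2-dimensional if every triple of distinct generators
generates an infinite subgroup. -/
def TwoDimensional (cs : CoxeterSystem M W) : Prop :=
  ∀ i j k : B, i ≠ j → i ≠ k → j ≠ k →
    Infinite (Subgroup.closure {cs.simple i, cs.simple j, cs.simple k} : Subgroup W)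

/-- The wall of the reflection `ρ` separates `g` and `h`. -/
def Separates (cs : CoxeterSystem M W) (ρ g h : W) : Prop :=
  Xor' (cs.length (ρ * g) < cs.length g) (cs.length (ρ * h) < cs.length h)

/-- `h` is adjacent to the wall of the reflection `ρ`. -/
def AdjacentWall (cs : CoxeterSystem M W) (ρ h : W) : Prop :=
  ∃ i : B, ρ = h * cs.simple i * h⁻¹

/-- The wall of `ρ'` separates `g` from the wall of `ρ`. -/
def SeparatesFromWall (cs : CoxeterSystem M W) (ρ' g ρ : W) : Prop :=
  ∀ h : W, AdjacentWall cs ρ h → Separates cs ρ' g h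

/-- `𝓦(g)`: the set of walls (identified with their reflections) separating `g` from the
identity and not separated from `g` by any other wall. -/
def WallsNear (cs : CoxeterSystem M W) (g : W) : Set W :=
  {ρ | cs.IsReflection ρ ∧ cs.length (ρ * g) < cs.length g ∧
    ∀ ρ' : W, cs.IsReflection ρ' → ρ' ≠ ρ → ¬ SeparatesFromWall cs ρ' g ρ}

set_option linter.unusedSectionVars false

/-! ### The geometric representation -/

/-- The Chebyshev-type sequence `0, 1, c, c² - 1, …`; for `c = 2 cos θ` its `k`-th term
is `sin (k θ) / sin θ`. -/
def chebSeq (c : ℝ) : ℕ → ℝ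
  | 0 => 0
  | 1 => 1
  | k + 2 => c * chebSeq c (k + 1) - chebSeq c k

theorem chebSeq_mul_sin (θ : ℝ) (k : ℕ) :
    chebSeq (2 * Real.cos θ) k * Real.sin θ = Real.sin (k * θ) := by
  induction k using Nat.twoStepInduction with
  | zero => simp [chebSeq]
  | one => simp [chebSeq]
  | more k h0 h1 =>
    have e2 : ((k + 2 : ℕ) : ℝ) * θ = ((k + 1 : ℕ) : ℝ) * θ + θ := by push_cast; ring
    have e0 : (k : ℝ) * θ = ((k + 1 : ℕ) : ℝ) * θ - θ := by push_cast; ring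
    rw [e0, Real.sin_sub] at h0
    rw [e2, Real.sin_add, chebSeq, sub_mul, h0, mul_assoc, h1]
    ring

theorem chebSeq_two (k : ℕ) : chebSeq 2 k = k := by
  induction k using Nat.twoStepInduction with
  | zero => simp [chebSeq]
  | one => simp [chebSeq]
  | more k h0 h1 => rw [chebSeq, h0, h1]; push_cast; ring

/-- The coefficient `-2 cos (π / m)`; the convention `m = 0` for `∞` gives `-2`. -/
noncomputable def cartan (M : CoxeterMatrix B) (i j : B) : ℝ := -2 * Real.cos (Real.pi / M.M i j)

theorem cartan_symm (M : CoxeterMatrix B) (i j : B) : cartan M i j = cartan M j i := by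
  unfold cartan
  rw [show M.M i j = M.M j i from M.symmetric i j]

theorem cartan_self (M : CoxeterMatrix B) (i : B) : cartan M i i = 2 := by
  simp [cartan]

theorem two_le_of_ne_zero (M : CoxeterMatrix B) {i j : B} (hij : i ≠ j) (h : M.M i j ≠ 0) :
    2 ≤ M.M i j := by
  have := M.off_diagonal i j hij
  omega

theorem cos_pi_div_mono {m n : ℕ} (hm : 2 ≤ m) (h : n = 0 ∨ m ≤ n) :
    Real.cos (Real.pi / m) ≤ Real.cos (Real.pi / n) := by
  have hm' : (2 : ℝ) ≤ m := by exact_mod_cast hm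
  have hpi := Real.pi_pos
  apply Real.cos_le_cos_of_nonneg_of_le_pi (by positivity)
  · exact div_le_self hpi.le (by linarith)
  · rcases h with rfl | h
    · simp; positivity
    · gcongr

theorem cartan_le (M : CoxeterMatrix B) {i j : B} {m : ℕ} (hm : 2 ≤ m)
    (h : M.M i j = 0 ∨ m ≤ M.M i j) : cartan M i j ≤ -2 * Real.cos (Real.pi / m) := by
  have := cos_pi_div_mono hm h
  unfold cartan
  linarith

theorem cartan_nonpos (M : CoxeterMatrix B) {i j : B} (hij : i ≠ j) : cartan M i j ≤ 0 := by
  have := cartan_le M (i := i) (j := j) (m := 2) le_rfl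
    ((eq_or_ne _ 0).imp_right (two_le_of_ne_zero M hij))
  simpa using this

theorem sin_pi_div_pos {m : ℕ} (hm : 2 ≤ m) : 0 < Real.sin (Real.pi / m) := by
  have hm' : (2 : ℝ) ≤ m := by exact_mod_cast hm
  have hpi := Real.pi_pos
  exact Real.sin_pos_of_pos_of_lt_pi (by positivity) (div_lt_self hpi (by linarith))

theorem chebSeq_cartan_nonneg (M : CoxeterMatrix B) {i j : B} (hij : i ≠ j) {k : ℕ}
    (hk : M.M i j = 0 ∨ k ≤ M.M i j) : 0 ≤ chebSeq (-cartan M i j) k := by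
  by_cases h0 : M.M i j = 0
  · simp [cartan, h0, chebSeq_two]
  · have h2 := two_le_of_ne_zero M hij h0
    have hk := hk.resolve_left h0
    have hs := sin_pi_div_pos h2
    have h := chebSeq_mul_sin (Real.pi / M.M i j) k
    have hpos : 0 ≤ Real.sin (k * (Real.pi / M.M i j)) := by
      apply Real.sin_nonneg_of_nonneg_of_le_pi
      · have := Real.pi_pos; positivity
      · have hk' : (k : ℝ) ≤ M.M i j := by exact_mod_cast hk
        have h2' : (2 : ℝ) ≤ M.M i j := by exact_mod_cast h2
        rw [mul_div_assoc', div_le_iff₀ (by linarith), mul_comm]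
        exact mul_le_mul_of_nonneg_left hk' Real.pi_pos.le
    rw [← h] at hpos
    simpa [cartan] using nonneg_of_mul_nonneg_left hpos hs

/-- The simple root indexed by `i`. -/
noncomputable def simpleRoot (i : B) : B → ℝ := Pi.single i 1

theorem simpleRoot_nonneg (i : B) : 0 ≤ simpleRoot i := by
  simp [simpleRoot]

/-- The functional dual to the simple root indexed by `i`. -/
noncomputable def simpleCoroot (M : CoxeterMatrix B) (i : B) : (B → ℝ) →ₗ[ℝ] ℝ :=
  ∑ j, cartan M i j • LinearMap.proj j

@[simp]
theorem simpleCoroot_simpleRoot (M : CoxeterMatrix B) (i j : B) :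
    simpleCoroot M i (simpleRoot j) = cartan M i j := by
  simp [simpleCoroot, simpleRoot, Pi.single_apply]

/-- The reflection in the simple root indexed by `i`. -/
noncomputable def simpleRefl (M : CoxeterMatrix B) (i : B) : Module.End ℝ (B → ℝ) :=
  LinearMap.id - (simpleCoroot M i).smulRight (simpleRoot i)

theorem simpleRefl_apply (M : CoxeterMatrix B) (i : B) (v : B → ℝ) :
    simpleRefl M i v = v - simpleCoroot M i v • simpleRoot i := by
  simp [simpleRefl]

theorem simpleRefl_mul_pow_left (M : CoxeterMatrix B) (i j : B) (k : ℕ) :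
    ((simpleRefl M i * simpleRefl M j) ^ k) (simpleRoot i) =
      chebSeq (-cartan M i j) (2 * k + 1) • simpleRoot i +
        chebSeq (-cartan M i j) (2 * k) • simpleRoot j := by
  induction k with
  | zero => simp [chebSeq]
  | succ k ih =>
    rw [pow_succ', Module.End.mul_apply, ih]
    simp only [Module.End.mul_apply, map_add, map_smul, simpleRefl_apply, map_sub,
      simpleCoroot_simpleRoot, cartan_self, cartan_symm M j i, mul_add, chebSeq]
    module

theorem simpleRefl_mul_pow_right (M : CoxeterMatrix B) (i j : B) (k : ℕ) :
    ((simpleRefl M i * simpleRefl M j) ^ k) (simpleRoot j) =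
      -chebSeq (-cartan M i j) (2 * k) • simpleRoot i +
        (chebSeq (-cartan M i j) (2 * k + 1) + cartan M i j * chebSeq (-cartan M i j) (2 * k)) •
          simpleRoot j := by
  induction k with
  | zero => simp [chebSeq]
  | succ k ih =>
    rw [pow_succ', Module.End.mul_apply, ih]
    simp only [Module.End.mul_apply, map_add, map_smul, simpleRefl_apply, map_sub,
      simpleCoroot_simpleRoot, cartan_self, cartan_symm M j i, mul_add, chebSeq]
    module

theorem simpleRefl_isLiftable (M : CoxeterMatrix B) : M.IsLiftable (simpleRefl M) := by
  intro i j
  rcases eq_or_ne i j with rfl | hij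
  · change (simpleRefl M i * simpleRefl M i) ^ M.M i i = 1
    rw [M.diagonal i, pow_one]
    refine LinearMap.ext fun v ↦ ?_
    simp only [Module.End.mul_apply, simpleRefl_apply, map_sub, map_smul, simpleCoroot_simpleRoot,
      cartan_self, Module.End.one_apply]
    module
  change (simpleRefl M i * simpleRefl M j) ^ M.M i j = 1
  by_cases h0 : M.M i j = 0
  · rw [h0, pow_zero]
  have h2 := two_le_of_ne_zero M hij h0
  have hs := sin_pi_div_pos h2
  have hM : (M.M i j : ℝ) ≠ 0 := by exact_mod_cast h0
  set c := cartan M i j with hc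
  have hcos : -c = 2 * Real.cos (Real.pi / M.M i j) := by simp [hc, cartan]
  have hU0 : chebSeq (-c) (2 * M.M i j) = 0 := by
    have h := chebSeq_mul_sin (Real.pi / M.M i j) (2 * M.M i j)
    rw [← hcos, show ((2 * M.M i j : ℕ) : ℝ) * (Real.pi / M.M i j) = 2 * Real.pi by
      push_cast; field_simp, Real.sin_two_pi] at h
    exact (mul_eq_zero.mp h).resolve_right hs.ne'
  have hU1 : chebSeq (-c) (2 * M.M i j + 1) = 1 := by
    have h := chebSeq_mul_sin (Real.pi / M.M i j) (2 * M.M i j + 1)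
    rw [← hcos, show ((2 * M.M i j + 1 : ℕ) : ℝ) * (Real.pi / M.M i j) =
      Real.pi / M.M i j + 2 * Real.pi by push_cast; field_simp; ring, Real.sin_add_two_pi] at h
    exact mul_right_cancel₀ hs.ne' (h.trans (one_mul _).symm)
  have hleft := simpleRefl_mul_pow_left M i j (M.M i j)
  have hright := simpleRefl_mul_pow_right M i j (M.M i j)
  rw [← hc, hU0, hU1] at hleft hright
  have hd : 4 - c ^ 2 ≠ 0 := by
    have := Real.sin_sq_add_cos_sq (Real.pi / M.M i j)
    have h4 : 4 - c ^ 2 = 4 * Real.sin (Real.pi / M.M i j) ^ 2 := by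
      rw [← neg_sq c, hcos]; linarith
    rw [h4]; positivity
  refine LinearMap.ext fun v ↦ ?_
  set x := simpleCoroot M i v with hx
  set y := simpleCoroot M j v with hy
  set a := (2 * x - c * y) / (4 - c ^ 2) with ha
  set b := (2 * y - c * x) / (4 - c ^ 2) with hb
  set u := v - (a • simpleRoot i + b • simpleRoot j) with hu
  have hui : simpleCoroot M i u = 0 := by
    simp only [hu, map_sub, map_add, map_smul, simpleCoroot_simpleRoot, cartan_self, ← hx, ← hc,
      smul_eq_mul, ha, hb]
    field_simp
    ring
  have huj : simpleCoroot M j u = 0 := by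
    simp only [hu, map_sub, map_add, map_smul, simpleCoroot_simpleRoot, cartan_self, ← hy,
      cartan_symm M j i, ← hc, smul_eq_mul, ha, hb]
    field_simp
    ring
  have hfix : ∀ k : ℕ, ((simpleRefl M i * simpleRefl M j) ^ k) u = u := by
    intro k
    induction k with
    | zero => simp
    | succ k ih =>
      rw [pow_succ', Module.End.mul_apply, ih, Module.End.mul_apply, simpleRefl_apply M j, huj,
        zero_smul, sub_zero, simpleRefl_apply, hui, zero_smul, sub_zero]
  have hv : v = u + (a • simpleRoot i + b • simpleRoot j) := by simp [hu]
  rw [hv, map_add, hfix, map_add, map_smul, map_smul, hleft, hright, Module.End.one_apply]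
  module

/-- The geometric representation of a Coxeter group. -/
noncomputable def geomRep (cs : CoxeterSystem M W) : W →* Module.End ℝ (B → ℝ) :=
  cs.lift ⟨simpleRefl M, simpleRefl_isLiftable M⟩

theorem geomRep_mul_simple (cs : CoxeterSystem M W) (w : W) (i : B) (v : B → ℝ) :
    geomRep cs (w * cs.simple i) v =
      geomRep cs w v - simpleCoroot M i v • geomRep cs w (simpleRoot i) := by
  have h : geomRep cs (cs.simple i) = simpleRefl M i :=
    cs.lift_apply_simple (simpleRefl_isLiftable M) i
  rw [map_mul, Module.End.mul_apply, h, simpleRefl_apply, map_sub, map_smul]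

theorem geomRep_mul_simple_self (cs : CoxeterSystem M W) (w : W) (i : B) :
    geomRep cs (w * cs.simple i) (simpleRoot i) = -geomRep cs w (simpleRoot i) := by
  rw [geomRep_mul_simple, simpleCoroot_simpleRoot, cartan_self]
  module

theorem geomRep_simpleRoot_ne_zero (cs : CoxeterSystem M W) (w : W) (i : B) :
    geomRep cs w (simpleRoot i) ≠ 0 := by
  intro h
  have h1 : geomRep cs (w⁻¹ * w) (simpleRoot i) = 0 := by
    rw [map_mul, Module.End.mul_apply, h, map_zero]
  rw [inv_mul_cancel, map_one] at h1
  simpa [simpleRoot] using congrFun h1 i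

theorem geomRep_alternatingWord (cs : CoxeterSystem M W) (i j : B) (v : W) (k : ℕ) :
    geomRep cs (v * cs.wordProd (alternatingWord i j k)) (simpleRoot i) =
      chebSeq (-cartan M i j) (k + 1) • geomRep cs v (simpleRoot (if Even k then i else j)) +
        chebSeq (-cartan M i j) k • geomRep cs v (simpleRoot (if Even k then j else i)) := by
  induction k generalizing v with
  | zero => simp [chebSeq, alternatingWord]
  | succ k ih =>
    rw [alternatingWord_succ', cs.wordProd_cons, ← mul_assoc, ih]
    by_cases hk : Even k
    · simp only [hk, if_true, Nat.even_add_one, not_true_eq_false, if_false, chebSeq,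
        geomRep_mul_simple, simpleCoroot_simpleRoot, cartan_self, cartan_symm M j i]
      module
    · simp only [hk, if_true, Nat.even_add_one, not_false_eq_true, if_false, chebSeq,
        geomRep_mul_simple, simpleCoroot_simpleRoot, cartan_self]
      module

/-- If `j` but not `i` is a right descent of `w`, then `w` splits off an alternating word in `i`
and `j` with additive lengths such that the remaining factor has no descent in `{i, j}`. -/
theorem exists_mul_alternatingWord (cs : CoxeterSystem M W) {w : W} {i j : B} (hij : i ≠ j)
    (hi : ¬cs.IsRightDescent w i) (hj : cs.IsRightDescent w j) :
    ∃ (v : W) (k : ℕ), w = v * cs.wordProd (alternatingWord i j k) ∧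
      cs.length v < cs.length w ∧ (M.M i j = 0 ∨ k < M.M i j) ∧
      ¬cs.IsRightDescent v i ∧ ¬cs.IsRightDescent v j := by
  set A : ℕ → W := fun k ↦ cs.wordProd (alternatingWord i j k) with hA
  have hAs (k : ℕ) : A (k + 1) = cs.simple (if Even k then j else i) * A k := by
    simp only [hA]
    rw [alternatingWord_succ', cs.wordProd_cons]
  have hAlen (k : ℕ) : cs.length (A k) ≤ k := by
    simpa using cs.length_wordProd_le (alternatingWord i j k)
  let Q : ℕ → Prop := fun k ↦ cs.length (w * (A k)⁻¹) + k = cs.length w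
  have hQ1 : Q 1 := by
    have h := cs.isRightDescent_iff.mp hj
    simpa [Q, hA, alternatingWord] using h
  have hex : ∃ n, ¬Q (n + 1) := ⟨cs.length w, fun h ↦ by simp only [Q] at h; omega⟩
  obtain ⟨k, hk, hmin⟩ : ∃ k, ¬Q (k + 1) ∧ ∀ m < k, Q (m + 1) :=
    ⟨Nat.find hex, Nat.find_spec hex, fun m hm ↦ not_not.mp (Nat.find_min hex hm)⟩
  obtain ⟨l, rfl⟩ : ∃ l, k = l + 1 :=
    Nat.exists_eq_succ_of_ne_zero (by rintro rfl; exact hk hQ1)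
  have hQ : Q (l + 1) := hmin l (Nat.lt_succ_self l)
  have hw : w = w * (A (l + 1))⁻¹ * A (l + 1) := by group
  simp only [Q] at hQ hk
  set v := w * (A (l + 1))⁻¹ with hv
  have hnext : ¬cs.IsRightDescent v (if Even (l + 1) then j else i) := by
    intro h
    apply hk
    rw [cs.isRightDescent_iff] at h
    rw [hAs (l + 1), mul_inv_rev, cs.inv_simple, ← mul_assoc, ← hv]
    omega
  have hprev : ¬cs.IsRightDescent v (if Even l then j else i) := by
    intro h
    rw [cs.isRightDescent_iff] at h
    have h1 : w = v * cs.simple (if Even l then j else i) * A l := by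
      rw [mul_assoc, ← hAs]; exact hw
    have h2 := cs.length_mul_le (v * cs.simple (if Even l then j else i)) (A l)
    rw [← h1] at h2
    have := hAlen l
    omega
  refine ⟨v, l + 1, hw, by omega, ?_, ?_⟩
  · by_contra! hM
    have h2 := two_le_of_ne_zero M hij hM.1
    obtain ⟨m, hm⟩ : ∃ m, M.M i j = m + 1 := Nat.exists_eq_succ_of_ne_zero hM.1
    have hQm := hmin m (by omega)
    simp only [Q] at hQm
    have hbraid : A (m + 1) = A m * cs.simple i := by
      have h := cs.wordProd_braidWord_eq i j
      have e1 : M i j = m + 1 := hm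
      have e2 : M j i = m + 1 := (M.symmetric j i).trans hm
      rw [braidWord, braidWord, e1, e2, alternatingWord_succ j i, List.concat_eq_append,
        cs.wordProd_append] at h
      simpa using h
    have h1 : w * cs.simple i = w * (A (m + 1))⁻¹ * A m := by
      rw [hbraid]; simp [mul_assoc]
    have h3 := cs.length_mul_le (w * (A (m + 1))⁻¹) (A m)
    rw [← h1] at h3
    have := hAlen m
    rw [cs.not_isRightDescent_iff] at hi
    omega
  · by_cases hl : Even l
    · simp only [hl, Nat.even_add_one, if_true, not_true_eq_false, if_false] at hnext hprev
      exact ⟨hnext, hprev⟩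
    · simp only [hl, Nat.even_add_one, if_true, not_false_eq_true, if_false] at hnext hprev
      exact ⟨hprev, hnext⟩

theorem geomRep_nonneg_of_not_isRightDescent (cs : CoxeterSystem M W) {w : W} {i : B}
    (hi : ¬cs.IsRightDescent w i) : 0 ≤ geomRep cs w (simpleRoot i) := by
  induction hn : cs.length w using Nat.strong_induction_on generalizing w i with
  | _ n ih =>
    by_cases hw : w = 1
    · rw [hw, map_one]
      exact simpleRoot_nonneg i
    obtain ⟨j, hj⟩ := cs.exists_rightDescent_of_ne_one hw
    have hij : i ≠ j := by rintro rfl; exact hi hj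
    obtain ⟨v, k, hwv, hlt, hk, hvi, hvj⟩ := exists_mul_alternatingWord cs hij hi hj
    have hi' := ih _ (hn ▸ hlt) hvi rfl
    have hj' := ih _ (hn ▸ hlt) hvj rfl
    have h0 := chebSeq_cartan_nonneg M hij (k := k) (hk.imp_right le_of_lt)
    have h1 := chebSeq_cartan_nonneg M hij (k := k + 1) (hk.imp_right id)
    rw [hwv, geomRep_alternatingWord]
    apply add_nonneg <;> refine smul_nonneg (by assumption) ?_ <;> split_ifs <;> assumption

theorem isRightDescent_iff_geomRep_nonpos (cs : CoxeterSystem M W) {w : W} {i : B} :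
    cs.IsRightDescent w i ↔ geomRep cs w (simpleRoot i) ≤ 0 := by
  constructor
  · intro h
    rw [cs.isRightDescent_iff_not_isRightDescent_mul] at h
    have := geomRep_nonneg_of_not_isRightDescent cs h
    rw [geomRep_mul_simple_self] at this
    exact neg_nonneg.mp this
  · intro h
    by_contra hi
    exact geomRep_simpleRoot_ne_zero cs w i
      (le_antisymm h (geomRep_nonneg_of_not_isRightDescent cs hi))

theorem le_geomRep_of_simpleCoroot_nonpos (cs : CoxeterSystem M W) {v : B → ℝ}
    (hv : ∀ i, simpleCoroot M i v ≤ 0) (w : W) : v ≤ geomRep cs w v := by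
  induction hn : cs.length w using Nat.strong_induction_on generalizing w with
  | _ n ih =>
    by_cases hw : w = 1
    · simp [hw]
    obtain ⟨i, hi⟩ := cs.exists_rightDescent_of_ne_one hw
    have h1 := ih _ (hn ▸ hi) (w * cs.simple i) rfl
    have h2 := geomRep_nonneg_of_not_isRightDescent cs
      (cs.isRightDescent_iff_not_isRightDescent_mul.mp hi)
    have h3 := geomRep_mul_simple cs (w * cs.simple i) i v
    rw [cs.simple_mul_simple_cancel_right] at h3
    rw [h3]
    have h4 := smul_nonneg (neg_nonneg.mpr (hv i)) h2
    rw [neg_smul] at h4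
    rw [sub_eq_add_neg]
    exact le_add_of_le_of_nonneg h1 h4

/-! ### Finiteness of the spherical triangle groups containing a braid relation of length three -/

theorem finite_closure_of_finite_invariant_cosets {G : Type*} [Group G] {H : Subgroup G}
    (hH : Finite H) {X : Set G} (hX : ∀ x ∈ X, x * x = 1) {F : Set (G ⧸ H)} (hF : F.Finite)
    (h1 : ((1 : G) : G ⧸ H) ∈ F) (hsmul : ∀ x ∈ X, ∀ c ∈ F, x • c ∈ F) :
    Finite (Subgroup.closure X) := by
  have hmem : ∀ g ∈ Subgroup.closure X, (g : G ⧸ H) ∈ F := by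
    intro g hg
    induction hg using Subgroup.closure_induction_left with
    | one => exact h1
    | mul_left x hx y _ ih => exact hsmul x hx _ ih
    | inv_mul_cancel x hx y _ ih =>
      rw [inv_eq_of_mul_eq_one_left (hX x hx)]
      exact hsmul x hx _ ih
  have hpre : (((↑) : G → G ⧸ H) ⁻¹' F).Finite := by
    refine hF.preimage' fun c _ ↦ ?_
    obtain ⟨g, rfl⟩ := QuotientGroup.mk_surjective c
    refine (Set.Finite.image (fun h ↦ g * h) (Set.toFinite (H : Set G))).subset fun y hy ↦ ?_
    exact ⟨g⁻¹ * y, QuotientGroup.eq.mp (Eq.symm hy), by simp⟩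
  exact (hpre.subset hmem).to_subtype

theorem finite_closure_pair {G : Type*} [Group G] {s r : G} (hs : s * s = 1) (hr : r * r = 1)
    {n : ℕ} (hn : n ≠ 0) (hsr : (s * r) ^ n = 1) :
    Finite (Subgroup.closure {s, r} : Subgroup G) := by
  have hfin : IsOfFinOrder (s * r) :=
    isOfFinOrder_iff_pow_eq_one.mpr ⟨n, Nat.pos_of_ne_zero hn, hsr⟩
  have hH : Finite (Subgroup.zpowers (s * r)) := hfin.finite_zpowers
  have hs' : s⁻¹ = s := inv_eq_of_mul_eq_one_left hs
  have e1 : ((r : G) : G ⧸ Subgroup.zpowers (s * r)) = (s : G) := by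
    rw [eq_comm, QuotientGroup.eq, hs']
    exact Subgroup.mem_zpowers _
  have e2 : ((r * s : G) : G ⧸ Subgroup.zpowers (s * r)) = (1 : G) := by
    rw [QuotientGroup.eq, mul_inv_rev, inv_eq_of_mul_eq_one_left hr, hs', mul_one]
    exact Subgroup.mem_zpowers _
  refine finite_closure_of_finite_invariant_cosets hH (X := {s, r})
    (F := {((1 : G) : G ⧸ Subgroup.zpowers (s * r)), ((s : G) : G ⧸ Subgroup.zpowers (s * r))})
    ?_ (Set.toFinite _) (by simp) ?_
  · rintro x (rfl | rfl) <;> assumption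
  · rintro x (rfl | rfl) c (rfl | rfl) <;>
      simp only [MulAction.Quotient.smul_mk, smul_eq_mul, mul_one, hs, e1, e2,
        Set.mem_insert_iff, Set.mem_singleton_iff, true_or, or_true]

theorem exists_finite_invariant_of_braid_three {α : Type*} {s t r : α → α} {x : α}
    (hs : ∀ c, s (s c) = c) (ht : ∀ c, t (t c) = c) (hr : ∀ c, r (r c) = c)
    (hst : ∀ c, s (t (s c)) = t (s (t c))) (htr : ∀ c, t (r c) = r (t c))
    (hsr : ∀ c, s (r (s c)) = r (s (r c))) (hsx : s x = x) (hrx : r x = x) :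
    ∃ F : Set α, F.Finite ∧ x ∈ F ∧ ∀ c ∈ F, s c ∈ F ∧ t c ∈ F ∧ r c ∈ F := by
  obtain ⟨x1, h1⟩ : ∃ y, y = t x := ⟨_, rfl⟩
  obtain ⟨x2, h2⟩ : ∃ y, y = s x1 := ⟨_, rfl⟩
  obtain ⟨x3, h3⟩ : ∃ y, y = r x2 := ⟨_, rfl⟩
  have r1 : r x1 = x1 := by rw [h1, ← htr, hrx]
  have t2 : t x2 = x2 := by rw [h2, h1, ← hst, hsx]
  have t3 : t x3 = x3 := by rw [h3, htr, t2]
  have s3 : s x3 = x3 := by rw [h3, h2, hsr, r1]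
  refine ⟨{x, x1, x2, x3}, Set.toFinite _, by simp, ?_⟩
  have t1 : t x1 = x := by rw [h1, ht]
  have s2 : s x2 = x1 := by rw [h2, hs]
  have r3 : r x3 = x2 := by rw [h3, hr]
  rintro c (rfl | rfl | rfl | rfl) <;>
    simp [hsx, hrx, ← h1, ← h2, ← h3, r1, t2, t3, s3, t1, s2, r3]

theorem exists_finite_invariant_of_braid_four {α : Type*} {s t r : α → α} {x : α}
    (hs : ∀ c, s (s c) = c) (ht : ∀ c, t (t c) = c) (hr : ∀ c, r (r c) = c)
    (hst : ∀ c, s (t (s c)) = t (s (t c))) (htr : ∀ c, t (r c) = r (t c))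
    (hsr : ∀ c, s (r (s (r c))) = r (s (r (s c)))) (hsx : s x = x) (hrx : r x = x) :
    ∃ F : Set α, F.Finite ∧ x ∈ F ∧ ∀ c ∈ F, s c ∈ F ∧ t c ∈ F ∧ r c ∈ F := by
  obtain ⟨x1, h1⟩ : ∃ y, y = t x := ⟨_, rfl⟩
  obtain ⟨x2, h2⟩ : ∃ y, y = s x1 := ⟨_, rfl⟩
  obtain ⟨x3, h3⟩ : ∃ y, y = r x2 := ⟨_, rfl⟩
  obtain ⟨x4, h4⟩ : ∃ y, y = s x3 := ⟨_, rfl⟩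
  obtain ⟨x5, h5⟩ : ∃ y, y = t x4 := ⟨_, rfl⟩
  have r1 : r x1 = x1 := by rw [h1, ← htr, hrx]
  have t2 : t x2 = x2 := by rw [h2, h1, ← hst, hsx]
  have t3 : t x3 = x3 := by rw [h3, htr, t2]
  have r4 : r x4 = x4 := by rw [h4, h3, h2, ← hsr, r1]
  have r5 : r x5 = x5 := by rw [h5, ← htr, r4]
  have s5 : s x5 = x5 := by rw [h5, h4, hst, t3]
  refine ⟨{x, x1, x2, x3, x4, x5}, Set.toFinite _, by simp, ?_⟩
  have t1 : t x1 = x := by rw [h1, ht]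
  have s2 : s x2 = x1 := by rw [h2, hs]
  have r3 : r x3 = x2 := by rw [h3, hr]
  have s4 : s x4 = x3 := by rw [h4, hs]
  have t5 : t x5 = x4 := by rw [h5, ht]
  rintro c (rfl | rfl | rfl | rfl | rfl | rfl) <;>
    simp [hsx, hrx, ← h1, ← h2, ← h3, ← h4, ← h5, r1, t2, t3, r4, r5, s5, t1, s2, r3, s4, t5]

theorem exists_finite_invariant_of_braid_five {α : Type*} {s t r : α → α} {x : α}
    (hs : ∀ c, s (s c) = c) (ht : ∀ c, t (t c) = c) (hr : ∀ c, r (r c) = c)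
    (hst : ∀ c, s (t (s c)) = t (s (t c))) (htr : ∀ c, t (r c) = r (t c))
    (hsr : ∀ c, s (r (s (r (s c)))) = r (s (r (s (r c))))) (hsx : s x = x) (hrx : r x = x) :
    ∃ F : Set α, F.Finite ∧ x ∈ F ∧ ∀ c ∈ F, s c ∈ F ∧ t c ∈ F ∧ r c ∈ F := by
  obtain ⟨x1, h1⟩ : ∃ y, y = t x := ⟨_, rfl⟩
  obtain ⟨x2, h2⟩ : ∃ y, y = s x1 := ⟨_, rfl⟩
  obtain ⟨x3, h3⟩ : ∃ y, y = r x2 := ⟨_, rfl⟩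
  obtain ⟨x4, h4⟩ : ∃ y, y = s x3 := ⟨_, rfl⟩
  obtain ⟨x5, h5⟩ : ∃ y, y = r x4 := ⟨_, rfl⟩
  obtain ⟨y5, k5⟩ : ∃ y, y = t x4 := ⟨_, rfl⟩
  obtain ⟨x6, h6⟩ : ∃ y, y = r y5 := ⟨_, rfl⟩
  obtain ⟨x7, h7⟩ : ∃ y, y = s x6 := ⟨_, rfl⟩
  obtain ⟨x8, h8⟩ : ∃ y, y = r x7 := ⟨_, rfl⟩
  obtain ⟨x9, h9⟩ : ∃ y, y = s x8 := ⟨_, rfl⟩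
  obtain ⟨x10, h10⟩ : ∃ y, y = t x9 := ⟨_, rfl⟩
  have r1 : r x1 = x1 := by rw [h1, ← htr, hrx]
  have t2 : t x2 = x2 := by rw [h2, h1, ← hst, hsx]
  have t3 : t x3 = x3 := by rw [h3, htr, t2]
  have s5 : s x5 = x5 := by rw [h5, h4, h3, h2, hsr, r1]
  have l5 : s y5 = y5 := by rw [k5, h4, hst, t3]
  have k6 : t x5 = x6 := by rw [h5, htr, ← k5, h6]
  have t7 : t x7 = x7 := by rw [h7, ← k6, ← hst, s5]
  have t8 : t x8 = x8 := by rw [h8, htr, t7]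
  have r9 : r x9 = x9 := by rw [h9, h8, h7, h6, ← hsr, l5]
  have r10 : r x10 = x10 := by rw [h10, ← htr, r9]
  have s10 : s x10 = x10 := by rw [h10, h9, hst, t8]
  refine ⟨{x, x1, x2, x3, x4, x5, y5, x6, x7, x8, x9, x10}, Set.toFinite _, by simp, ?_⟩
  have t1 : t x1 = x := by rw [h1, ht]
  have s2 : s x2 = x1 := by rw [h2, hs]
  have r3 : r x3 = x2 := by rw [h3, hr]
  have s4 : s x4 = x3 := by rw [h4, hs]
  have r5 : r x5 = x4 := by rw [h5, hr]
  have l5' : t y5 = x4 := by rw [k5, ht]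
  have r6 : r x6 = y5 := by rw [h6, hr]
  have t6 : t x6 = x5 := by rw [← k6, ht]
  have s7 : s x7 = x6 := by rw [h7, hs]
  have r8 : r x8 = x7 := by rw [h8, hr]
  have s9 : s x9 = x8 := by rw [h9, hs]
  have t10 : t x10 = x9 := by rw [h10, ht]
  rintro c (rfl | rfl | rfl | rfl | rfl | rfl | rfl | rfl | rfl | rfl | rfl | rfl) <;>
    simp [hsx, hrx, ← h1, ← h2, ← h3, ← h4, ← h5, ← k5, ← h6, ← h7, ← h8, ← h9, ← h10, r1, t2, t3,
      s5, l5, k6, t7, t8, r9, r10, s10, t1, s2, r3, s4, r5, l5', r6, t6, s7, r8, s9, t10]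

theorem finite_closure_triple {G : Type*} [Group G] {s t r : G} (hs : s * s = 1) (ht : t * t = 1)
    (hr : r * r = 1) (hst : (s * t) ^ 3 = 1) (htr : (t * r) ^ 2 = 1) {n : ℕ} (hn3 : 3 ≤ n)
    (hn5 : n ≤ 5) (hsr : (s * r) ^ n = 1) :
    Finite (Subgroup.closure {s, t, r} : Subgroup G) := by
  have hs' : s⁻¹ = s := inv_eq_of_mul_eq_one_left hs
  have ht' : t⁻¹ = t := inv_eq_of_mul_eq_one_left ht
  have hr' : r⁻¹ = r := inv_eq_of_mul_eq_one_left hr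
  set H : Subgroup G := Subgroup.closure {s, r} with hHdef
  have hH : Finite H := finite_closure_pair hs hr (by omega) hsr
  have hsx : s • ((1 : G) : G ⧸ H) = (1 : G) := by
    rw [MulAction.Quotient.smul_mk, eq_comm, QuotientGroup.eq]
    simpa using Subgroup.subset_closure (by simp)
  have hrx : r • ((1 : G) : G ⧸ H) = (1 : G) := by
    rw [MulAction.Quotient.smul_mk, eq_comm, QuotientGroup.eq]
    simpa using Subgroup.subset_closure (by simp)
  have hst' : s * (t * s) = t * (s * t) := by
    rw [← mul_inv_eq_one, ← hst]
    simp [pow_succ, mul_assoc, hs', ht']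
  have htr' : t * r = r * t := by
    rw [← mul_inv_eq_one, ← htr]
    simp [pow_succ, mul_assoc, ht', hr']
  have act {a : G} (ha : a * a = 1) (c : G ⧸ H) : a • a • c = c := by rw [smul_smul, ha, one_smul]
  have actst (c : G ⧸ H) : s • t • s • c = t • s • t • c := by simp only [smul_smul, hst']
  have acttr (c : G ⧸ H) : t • r • c = r • t • c := by simp only [smul_smul, htr']
  obtain ⟨F, hF, h1, hinv⟩ : ∃ F : Set (G ⧸ H), F.Finite ∧ ((1 : G) : G ⧸ H) ∈ F ∧
      ∀ c ∈ F, s • c ∈ F ∧ t • c ∈ F ∧ r • c ∈ F := by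
    obtain rfl | rfl | rfl : n = 3 ∨ n = 4 ∨ n = 5 := by omega
    · have hsr' : s * (r * s) = r * (s * r) := by
        rw [← mul_inv_eq_one, ← hsr]
        simp [pow_succ, mul_assoc, hs', hr']
      exact exists_finite_invariant_of_braid_three (s := (s • ·)) (t := (t • ·)) (r := (r • ·))
        (act hs) (act ht) (act hr) actst acttr (fun c ↦ by simp only [smul_smul, hsr']) hsx hrx
    · have hsr' : s * (r * (s * r)) = r * (s * (r * s)) := by
        rw [← mul_inv_eq_one, ← hsr]
        simp [pow_succ, mul_assoc, hs', hr']
      exact exists_finite_invariant_of_braid_four (s := (s • ·)) (t := (t • ·)) (r := (r • ·))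
        (act hs) (act ht) (act hr) actst acttr (fun c ↦ by simp only [smul_smul, hsr']) hsx hrx
    · have hsr' : s * (r * (s * (r * s))) = r * (s * (r * (s * r))) := by
        rw [← mul_inv_eq_one, ← hsr]
        simp [pow_succ, mul_assoc, hs', hr']
      exact exists_finite_invariant_of_braid_five (s := (s • ·)) (t := (t • ·)) (r := (r • ·))
        (act hs) (act ht) (act hr) actst acttr (fun c ↦ by simp only [smul_smul, hsr']) hsx hrx
  refine finite_closure_of_finite_invariant_cosets hH ?_ hF h1 ?_
  · rintro x (rfl | rfl | rfl) <;> assumption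
  · rintro x (rfl | rfl | rfl) c hc
    · exact (hinv c hc).1
    · exact (hinv c hc).2.1
    · exact (hinv c hc).2.2

/-! ### The dihedral residue of type `A₂` -/

theorem mem_closure_pair_of_braid_three {G : Type*} [Group G] {s t u : G} (hs : s * s = 1)
    (ht : t * t = 1) (hst : s * (t * s) = t * (s * t)) (hu : u ∈ Subgroup.closure {s, t}) :
    u = 1 ∨ u = s ∨ u = t ∨ u = s * t ∨ u = t * s ∨ u = s * (t * s) := by
  have hs1 (x : G) : s * (s * x) = x := by rw [← mul_assoc, hs, one_mul]
  have ht1 (x : G) : t * (t * x) = x := by rw [← mul_assoc, ht, one_mul]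
  have hmul : ∀ x ∈ ({s, t} : Set G), ∀ y : G,
      (y = 1 ∨ y = s ∨ y = t ∨ y = s * t ∨ y = t * s ∨ y = s * (t * s)) →
      (x * y = 1 ∨ x * y = s ∨ x * y = t ∨ x * y = s * t ∨ x * y = t * s ∨
        x * y = s * (t * s)) := by
    rintro x (rfl | rfl) y (rfl | rfl | rfl | rfl | rfl | rfl)
    · simp
    · simp [hs]
    · simp
    · simp [hs1]
    · simp
    · simp [hs1]
    · simp
    · simp
    · simp [ht]
    · simp [hst]
    · simp [ht1]
    · simp [hst, ht1]
  induction hu using Subgroup.closure_induction_left with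
  | one => simp
  | mul_left x hx y _ ih => exact hmul x hx y ih
  | inv_mul_cancel x hx y _ ih =>
    have hxx : x * x = 1 := by rcases hx with rfl | rfl <;> assumption
    rw [inv_eq_of_mul_eq_one_left hxx]
    exact hmul x hx y ih

theorem cartan_of_eq_three (M : CoxeterMatrix B) {i j : B} (h : M.M i j = 3) :
    cartan M i j = -1 := by
  simp [cartan, h]

theorem simple_braid_three (cs : CoxeterSystem M W) {i j : B} (h : M.M i j = 3) :
    cs.simple i * (cs.simple j * cs.simple i) = cs.simple j * (cs.simple i * cs.simple j) := by
  have h3 : (cs.simple i * cs.simple j) ^ M.M i j = 1 := cs.simple_mul_simple_pow i j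
  rw [← mul_inv_eq_one, ← h3, h]
  simp [pow_succ, mul_assoc]

section Residue

variable {cs : CoxeterSystem M W} {f : W} {i j : B}

theorem geomRep_mul_simple_of_eq_three (h : M.M i j = 3) (w : W) :
    geomRep cs (w * cs.simple i) (simpleRoot j) =
      geomRep cs w (simpleRoot j) + geomRep cs w (simpleRoot i) := by
  rw [geomRep_mul_simple, simpleCoroot_simpleRoot, cartan_of_eq_three M h]
  module

theorem isRightDescent_mul_simple_of_eq_three (h : M.M i j = 3) (hi : cs.IsRightDescent f i)
    (hj : cs.IsRightDescent f j) : cs.IsRightDescent (f * cs.simple i) j := by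
  rw [isRightDescent_iff_geomRep_nonpos] at *
  rw [geomRep_mul_simple_of_eq_three h]
  exact add_nonpos hj hi

theorem geomRep_mul_simple_mul_simple_of_eq_three (h : M.M i j = 3) (w : W) :
    geomRep cs (w * cs.simple i * cs.simple j) (simpleRoot i) = geomRep cs w (simpleRoot j) := by
  rw [geomRep_mul_simple_of_eq_three ((M.symmetric j i).trans h), geomRep_mul_simple_self,
    geomRep_mul_simple_of_eq_three h]
  abel

theorem three_le_length_of_eq_three (h : M.M i j = 3) (hi : cs.IsRightDescent f i)
    (hj : cs.IsRightDescent f j) :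
    3 ≤ cs.length (cs.simple i * (cs.simple j * cs.simple i)) := by
  have h1 := cs.isRightDescent_iff.mp hi
  have h2 := cs.isRightDescent_iff.mp (isRightDescent_mul_simple_of_eq_three h hi hj)
  have h3 : cs.IsRightDescent (f * cs.simple i * cs.simple j) i := by
    rw [isRightDescent_iff_geomRep_nonpos] at hj ⊢
    rwa [geomRep_mul_simple_mul_simple_of_eq_three h]
  have h3 := cs.isRightDescent_iff.mp h3
  have h4 := cs.length_le_length_mul_add_right f (cs.simple i * (cs.simple j * cs.simple i))
  rw [← mul_assoc, ← mul_assoc] at h4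
  omega

theorem length_simple_mul_simple_le (cs : CoxeterSystem M W) (i j : B) :
    cs.length (cs.simple i * cs.simple j) ≤ 2 := by
  simpa using cs.length_mul_le (cs.simple i) (cs.simple j)

theorem length_mem_closure_pair_le (h : M.M i j = 3) {u : W}
    (hu : u ∈ Subgroup.closure {cs.simple i, cs.simple j}) :
    u = cs.simple i * (cs.simple j * cs.simple i) ∨ cs.length u ≤ 2 := by
  rcases mem_closure_pair_of_braid_three (cs.simple_mul_simple_self i)
    (cs.simple_mul_simple_self j) (simple_braid_three cs h) hu with
    rfl | rfl | rfl | rfl | rfl | rfl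
  · simp
  · simp
  · simp
  · exact .inr (length_simple_mul_simple_le cs i j)
  · exact .inr (length_simple_mul_simple_le cs j i)
  · simp

theorem wg_eq_of_eq_three (h : M.M i j = 3) (hT : descentSet cs f = {i, j}) :
    wg cs f = cs.simple i * (cs.simple j * cs.simple i) := by
  have hi : cs.IsRightDescent f i := hT.symm.subset (by simp)
  have hj : cs.IsRightDescent f j := hT.symm.subset (by simp)
  have hlong := three_le_length_of_eq_three h hi hj
  have hD : descSubgroup cs f = Subgroup.closure {cs.simple i, cs.simple j} := by
    rw [descSubgroup, hT, Set.image_pair]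
  have hmi : cs.simple i ∈ Subgroup.closure {cs.simple i, cs.simple j} :=
    Subgroup.subset_closure (by simp)
  have hmj : cs.simple j ∈ Subgroup.closure {cs.simple i, cs.simple j} :=
    Subgroup.subset_closure (by simp)
  have hmem : cs.simple i * (cs.simple j * cs.simple i) ∈ descSubgroup cs f := by
    rw [hD]
    exact mul_mem hmi (mul_mem hmj hmi)
  have hex : ∃ w₀ ∈ descSubgroup cs f, ∀ u ∈ descSubgroup cs f, cs.length u ≤ cs.length w₀ := by
    refine ⟨_, hmem, fun u hu ↦ ?_⟩
    rw [hD] at hu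
    rcases length_mem_closure_pair_le h hu with rfl | hu
    · exact le_rfl
    · omega
  rw [wg, dif_pos hex]
  obtain ⟨hw, hmax⟩ := hex.choose_spec
  have hle := hmax _ hmem
  exact (length_mem_closure_pair_le h (hD.le hw)).resolve_right (by omega)

/-- In a residue of type `A₂` with top element `f`, the elements at distance `2` from `Π(f)` are
the neighbours of `f`. -/
theorem eq_mul_simple_of_length_eq_two (h : M.M i j = 3) (hT : descentSet cs f = {i, j}) {g : W}
    (hg : f⁻¹ * g ∈ Subgroup.closure {cs.simple i, cs.simple j})
    (hlen : cs.length ((PiMap cs f)⁻¹ * g) = 2) : g = f * cs.simple i ∨ g = f * cs.simple j := by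
  have hi : cs.IsRightDescent f i := hT.symm.subset (by simp)
  have hj : cs.IsRightDescent f j := hT.symm.subset (by simp)
  have hlong := three_le_length_of_eq_three h hi hj
  have hbraid := simple_braid_three cs h
  have hwinv : (cs.simple i * (cs.simple j * cs.simple i))⁻¹ =
      cs.simple i * (cs.simple j * cs.simple i) := by simp [mul_assoc]
  have hu : (PiMap cs f)⁻¹ * g = cs.simple i * (cs.simple j * cs.simple i) * (f⁻¹ * g) := by
    rw [PiMap, wg_eq_of_eq_three h hT, mul_inv_rev, hwinv, mul_assoc]
  rw [hu] at hlen
  rcases mem_closure_pair_of_braid_three (cs.simple_mul_simple_self i)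
    (cs.simple_mul_simple_self j) hbraid hg with h1 | h1 | h1 | h1 | h1 | h1
  · rw [h1, mul_one] at hlen; omega
  · left; rw [← h1]; group
  · right; rw [← h1]; group
  · rw [h1] at hlen; simp [mul_assoc] at hlen
  · rw [h1, hbraid] at hlen; simp [mul_assoc] at hlen
  · rw [h1] at hlen; simp [mul_assoc] at hlen

end Residue

theorem cartan_le_neg_one (M : CoxeterMatrix B) {i j : B} (hij : i ≠ j) (h : M.M i j ≠ 2) :
    cartan M i j ≤ -1 := by
  have h3 : M.M i j = 0 ∨ 3 ≤ M.M i j :=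
    (eq_or_ne _ 0).imp_right fun h0 ↦ by have := two_le_of_ne_zero M hij h0; omega
  simpa using cartan_le M (m := 3) (by norm_num) h3

theorem three_le_cartan_sq (M : CoxeterMatrix B) {i j : B} (h : M.M i j = 0 ∨ 6 ≤ M.M i j) :
    3 ≤ cartan M i j ^ 2 := by
  have h6 := cartan_le M (m := 6) (by norm_num) h
  rw [show ((6 : ℕ) : ℝ) = 6 by norm_num, Real.cos_pi_div_six] at h6
  have hs := Real.sq_sqrt (show (0 : ℝ) ≤ 3 by norm_num)
  nlinarith [Real.sqrt_nonneg (3 : ℝ)]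

/-- A vector supported on three simple roots is antidominant as soon as its pairings with the three
corresponding coroots are nonpositive. -/
theorem simpleCoroot_nonpos_of_triple (M : CoxeterMatrix B) {i j k : B} {a b d : ℝ} (ha : 0 ≤ a)
    (hb : 0 ≤ b) (hd : 0 ≤ d) (hi : a * 2 + b * cartan M i j + d * cartan M i k ≤ 0)
    (hj : a * cartan M i j + b * 2 + d * cartan M j k ≤ 0)
    (hk : a * cartan M i k + b * cartan M j k + d * 2 ≤ 0) (l : B) :
    simpleCoroot M l (a • simpleRoot i + b • simpleRoot j + d • simpleRoot k) ≤ 0 := by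
  simp only [map_add, map_smul, simpleCoroot_simpleRoot, smul_eq_mul]
  by_cases hli : l = i
  · subst hli; rwa [cartan_self]
  by_cases hlj : l = j
  · subst hlj; rwa [cartan_self, cartan_symm M l i]
  by_cases hlk : l = k
  · subst hlk; rwa [cartan_self, cartan_symm M l i, cartan_symm M l j]
  have h1 := mul_nonpos_of_nonneg_of_nonpos ha (cartan_nonpos M hli)
  have h2 := mul_nonpos_of_nonneg_of_nonpos hb (cartan_nonpos M hlj)
  have h3 := mul_nonpos_of_nonneg_of_nonpos hd (cartan_nonpos M hlk)
  linarith

/-- In an infinite triangle group with `m i j = 3` and `m i k ≠ 2` there is a nonzero antidominant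
vector in the span of the three simple roots, with a bound on its first coefficient. -/
theorem exists_antidominant_of_triple (cs : CoxeterSystem M W) (h2 : TwoDimensional cs)
    {i j k : B} (hij : i ≠ j) (hki : k ≠ i) (hkj : k ≠ j) (h3 : M.M i j = 3) (hik : M.M i k ≠ 2) :
    ∃ a b d : ℝ, 0 ≤ a ∧ 0 < b ∧ 0 ≤ d ∧ a ≤ d * -cartan M i k ∧
      ∀ l, simpleCoroot M l (a • simpleRoot i + b • simpleRoot j + d • simpleRoot k) ≤ 0 := by
  have hc3 := cartan_of_eq_three M h3
  have hc := cartan_le_neg_one M hki.symm hik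
  by_cases hjk : M.M j k = 2
  · have he : cartan M j k = 0 := by simp [cartan, hjk]
    have h6 : M.M i k = 0 ∨ 6 ≤ M.M i k := by
      by_contra! hlt
      have hge := two_le_of_ne_zero M hki.symm hlt.1
      refine (h2 i j k hij hki.symm hkj.symm).not_finite (finite_closure_triple
        (cs.simple_mul_simple_self i) (cs.simple_mul_simple_self j) (cs.simple_mul_simple_self k)
        ?_ ?_ (n := M.M i k) (by omega) (by omega) (cs.simple_mul_simple_pow i k))
      · exact h3 ▸ cs.simple_mul_simple_pow i j
      · exact hjk ▸ cs.simple_mul_simple_pow j k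
    have hsq := three_le_cartan_sq M h6
    refine ⟨2, 1, -cartan M i k, by norm_num, one_pos, by linarith, by nlinarith,
      simpleCoroot_nonpos_of_triple M (by norm_num) (by norm_num) (by linarith) ?_ ?_ ?_⟩
    · rw [hc3]; nlinarith
    · rw [hc3, he]; linarith
    · rw [he]; linarith
  · have he := cartan_le_neg_one M hkj.symm hjk
    refine ⟨1, 1, 1, by norm_num, one_pos, by norm_num, by linarith,
      simpleCoroot_nonpos_of_triple M (by norm_num) (by norm_num) (by norm_num) ?_ ?_ ?_⟩ <;>
      linarith

/-- **Corollary (iii).** If `m_st = 3` and `m = 2`, then `m_sr = 2`. -/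
theorem corollary_step1_iii
    (cs : CoxeterSystem M W) (h2 : TwoDimensional cs)
    (f : W) (i j : B) (hij : i ≠ j) (hTf : descentSet cs f = {i, j})
    (g : W) (hgR : f⁻¹ * g ∈ Subgroup.closure {cs.simple i, cs.simple j})
    (k : B) (hki : k ≠ i) (hkj : k ≠ j) (hTg : descentSet cs g = {i, k})
    (hst : M.M i j = 3) (hm : cs.length ((PiMap cs f)⁻¹ * g) = 2) :
    M.M i k = 2 := by
  by_contra hik
  have hfi : cs.IsRightDescent f i := hTf.symm.subset (by simp)
  have hfj : cs.IsRightDescent f j := hTf.symm.subset (by simp)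
  have hgi : cs.IsRightDescent g i := hTg.symm.subset (by simp)
  have hgk : cs.IsRightDescent g k := hTg.symm.subset (by simp)
  rcases eq_mul_simple_of_length_eq_two hst hTf hgR hm with hg | hg
  · have hgj : j ∈ descentSet cs g := by
      rw [hg]
      exact isRightDescent_mul_simple_of_eq_three hst hfi hfj
    rw [hTg] at hgj
    rcases hgj with rfl | rfl
    · exact hij rfl
    · exact hkj rfl
  · obtain ⟨a, b, d, ha, hb, hd, hac, hv⟩ :=
      exists_antidominant_of_triple cs h2 hij hki hkj hst hik
    have hle := le_geomRep_of_simpleCoroot_nonpos cs hv (g * cs.simple i)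
    have hroot : geomRep cs (g * cs.simple i) (simpleRoot j) = geomRep cs f (simpleRoot i) := by
      rw [hg, geomRep_mul_simple_mul_simple_of_eq_three ((M.symmetric j i).trans hst)]
    rw [isRightDescent_iff_geomRep_nonpos] at hfi hgi hgk
    simp only [map_add, map_smul, hroot] at hle
    rw [geomRep_mul_simple_self, geomRep_mul_simple, simpleCoroot_simpleRoot] at hle
    have hj := hle j
    have h1 := mul_nonpos_of_nonneg_of_nonpos (sub_nonneg.mpr hac) (hgi j)
    have h2 := mul_nonpos_of_nonneg_of_nonpos hb.le (hfi j)
    have h3 := mul_nonpos_of_nonneg_of_nonpos hd (hgk j)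
    simp [simpleRoot, hij.symm, hkj.symm] at hj h1 h2 h3
    linarith

end CoxeterPaper
end

section
/- Let W be a 2-dimensional Coxeter group. Let f ∈ W with T(f) = {s, t} for distinct s, t ∈ S (so that m_st < ∞), let h = Π(f), and let R = f⟨s,t⟩ be the {s,t}-residue containing f and h. Let g ∈ R, let m = ℓ(h⁻¹g), and suppose T(g) = {s, r} for some r ∈ S with r ∉ {s, t}. If m_st = 4, then m ≤ 2. -/
namespace CoxeterPaper

open CoxeterSystem

attribute [local instance] Classical.propDecidable

variable {B : Type} [DecidableEq B] [Fintype B]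
variable {W : Type} [Group W] {M : CoxeterMatrix B}

section Exchange

variable {ι G : Type*} [Group G] {N : CoxeterMatrix ι} (cs : CoxeterSystem N G)

/-- The action of the generator `i` on signed elements: conjugation by `cs.simple i`, together with
a change of sign exactly at `cs.simple i`. -/
noncomputable def signedConj (i : ι) : Function.End (G × ZMod 2) := fun p ↦
  (cs.simple i * p.1 * cs.simple i, p.2 + if p.1 = cs.simple i then 1 else 0)

theorem end_mul_apply {α : Type*} (f g : Function.End α) (x : α) : (f * g) x = f (g x) := rfl

theorem signedConj_mul_pow_apply (i j : ι) (n : ℕ) (p : G × ZMod 2) :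
    ((signedConj cs i * signedConj cs j) ^ n) p =
      ((cs.simple i * cs.simple j) ^ n * p.1 * ((cs.simple i * cs.simple j) ^ n)⁻¹,
        p.2 + ∑ k ∈ Finset.range (2 * n),
          if p.1 = cs.simple j * (cs.simple i * cs.simple j) ^ k then 1 else 0) := by
  induction n with
  | zero => simp [Function.End.one_def]
  | succ n ih =>
    have hflip : ∀ m : ℕ, cs.simple j * (cs.simple i * cs.simple j) ^ m =
        ((cs.simple i * cs.simple j) ^ m)⁻¹ * cs.simple j := by
      intro m
      rw [← inv_pow, mul_inv_rev, cs.inv_simple, cs.inv_simple]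
      induction m with
      | zero => simp
      | succ m ihm => rw [pow_succ, ← mul_assoc, ihm, pow_succ]; simp only [mul_assoc]
    rw [pow_succ', end_mul_apply, ih]
    have h1 : ((cs.simple i * cs.simple j) ^ n * p.1 * ((cs.simple i * cs.simple j) ^ n)⁻¹ =
        cs.simple j) ↔ p.1 = cs.simple j * (cs.simple i * cs.simple j) ^ (2 * n) := by
      rw [two_mul, pow_add, ← mul_assoc, hflip, mul_inv_eq_iff_eq_mul, ← eq_inv_mul_iff_mul_eq,
        mul_assoc]
    have h2 : (cs.simple j * ((cs.simple i * cs.simple j) ^ n * p.1 *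
        ((cs.simple i * cs.simple j) ^ n)⁻¹) * cs.simple j = cs.simple i) ↔
        p.1 = cs.simple j * (cs.simple i * cs.simple j) ^ (2 * n + 1) := by
      have : cs.simple j * (cs.simple i * cs.simple j) ^ (2 * n + 1) =
          ((cs.simple i * cs.simple j) ^ n)⁻¹ * (cs.simple j * cs.simple i * cs.simple j) *
            (cs.simple i * cs.simple j) ^ n := by
        rw [show 2 * n + 1 = n + (1 + n) by ring, pow_add, ← mul_assoc, hflip, pow_add, pow_one]
        simp only [mul_assoc]
      rw [this]
      generalize (cs.simple i * cs.simple j) ^ n = A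
      constructor
      · intro h
        rw [← h]
        simp [mul_assoc]
      · intro h
        rw [h]
        simp [mul_assoc]
    rw [end_mul_apply]
    simp only [signedConj, h1, h2]
    rw [show 2 * (n + 1) = 2 * n + 1 + 1 by ring, Finset.sum_range_succ, Finset.sum_range_succ]
    refine Prod.ext ?_ ?_
    · simp only [pow_succ', mul_inv_rev, cs.inv_simple, mul_assoc]
    · simp only [add_assoc]

theorem isLiftable_signedConj : N.IsLiftable (signedConj cs) := by
  intro i j
  funext p
  rw [signedConj_mul_pow_apply, cs.simple_mul_simple_pow, two_mul, Finset.sum_range_add]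
  simp only [pow_add, cs.simple_mul_simple_pow, one_mul]
  simp [CharTwo.add_self_eq_zero, Function.End.one_def]

theorem lift_signedConj_wordProd (ω : List ι) (p : G × ZMod 2) :
    cs.lift ⟨_, isLiftable_signedConj cs⟩ (cs.wordProd ω) p =
      (cs.wordProd ω * p.1 * (cs.wordProd ω)⁻¹, p.2 + (cs.rightInvSeq ω).count p.1) := by
  induction ω with
  | nil => simp [Function.End.one_def]
  | cons i ω ih =>
    rw [cs.wordProd_cons, map_mul, cs.lift_apply_simple, end_mul_apply, ih]
    have : cs.wordProd ω * p.1 * (cs.wordProd ω)⁻¹ = cs.simple i ↔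
        (cs.wordProd ω)⁻¹ * cs.simple i * cs.wordProd ω = p.1 := by
      rw [mul_inv_eq_iff_eq_mul, ← eq_inv_mul_iff_mul_eq, mul_assoc, eq_comm]
    simp only [signedConj, this]
    refine Prod.ext ?_ ?_
    · simp only [mul_inv_rev, cs.inv_simple, mul_assoc]
    · simp only [CoxeterSystem.rightInvSeq, List.count_cons, beq_iff_eq]
      push_cast
      rw [add_assoc]

/-- The exchange condition, in terms of the right inversion sequence. -/
theorem simple_mem_rightInvSeq {ω : List ι} {i : ι} (h : cs.IsRightDescent (cs.wordProd ω) i) :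
    cs.simple i ∈ cs.rightInvSeq ω := by
  obtain ⟨ω', hω', hprod⟩ := cs.exists_isReduced (cs.wordProd ω * cs.simple i)
  have hcat : cs.wordProd (ω'.concat i) = cs.wordProd ω := by
    rw [cs.wordProd_concat, ← hprod, cs.simple_mul_simple_cancel_right]
  have hred : cs.IsReduced (ω'.concat i) := by
    have h' := cs.isRightDescent_iff.1 h
    rw [hprod, hω'.eq] at h'
    rw [CoxeterSystem.IsReduced, hcat, ← h', List.length_concat]
  have hone : (cs.rightInvSeq (ω'.concat i)).count (cs.simple i) = 1 :=
    List.count_eq_one_of_mem hred.nodup_rightInvSeq (by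
      rw [cs.rightInvSeq_concat, List.concat_eq_append]
      simp)
  have hpar := lift_signedConj_wordProd cs (ω'.concat i) (cs.simple i, 0)
  rw [hcat, lift_signedConj_wordProd, hone] at hpar
  by_contra hmem
  simp [List.count_eq_zero_of_not_mem hmem] at hpar

theorem exists_wordProd_mul_eq_of_mem_rightInvSeq {ω : List ι} {t : G}
    (ht : t ∈ cs.rightInvSeq ω) :
    ∃ ω' : List ι, ω'.length + 1 = ω.length ∧ cs.wordProd ω * t = cs.wordProd ω' := by
  obtain ⟨n, hn, rfl⟩ := List.mem_iff_getElem.1 ht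
  have hn' : n < ω.length := by simpa using hn
  refine ⟨ω.eraseIdx n, ?_, ?_⟩
  · rw [List.length_eraseIdx_of_lt hn']
    omega
  · rw [← cs.wordProd_mul_getD_rightInvSeq, List.getD_eq_getElem]

theorem mem_rightInvSeq_append {ω ω' : List ι} {t : G} (ht : t ∈ cs.rightInvSeq (ω ++ ω')) :
    t ∈ cs.rightInvSeq ω' ∨
      ∃ u ∈ cs.rightInvSeq ω, t = (cs.wordProd ω')⁻¹ * u * cs.wordProd ω' := by
  induction ω with
  | nil => exact Or.inl ht
  | cons i ω ih =>
    rw [List.cons_append, CoxeterSystem.rightInvSeq, List.mem_cons] at ht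
    rcases ht with rfl | ht
    · refine Or.inr ⟨_, List.mem_cons_self, ?_⟩
      simp only [cs.wordProd_append, mul_inv_rev, mul_assoc]
    · rcases ih ht with h | ⟨u, hu, rfl⟩
      · exact Or.inl h
      · exact Or.inr ⟨u, List.mem_cons_of_mem _ hu, rfl⟩

theorem mem_rightInvSeq_alternatingWord {a b : ι} {n : ℕ} {t : G}
    (ht : t ∈ cs.rightInvSeq (alternatingWord a b n)) :
    ∃ k < n, t = cs.simple b * (cs.simple a * cs.simple b) ^ k := by
  induction n generalizing a b t with
  | zero => simp [alternatingWord] at ht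
  | succ n ih =>
    rw [alternatingWord, cs.rightInvSeq_concat, List.concat_eq_append, List.mem_append,
      List.mem_singleton, List.mem_map] at ht
    rcases ht with ⟨u, hu, rfl⟩ | rfl
    · obtain ⟨k, hk, rfl⟩ := ih hu
      refine ⟨k + 1, by omega, ?_⟩
      rw [MulAut.conj_apply, cs.inv_simple, pow_succ', mul_assoc, mul_assoc, mul_assoc,
        ← mul_pow_mul]
    · exact ⟨0, by omega, by simp⟩

/-- An element with two descents `a`, `b` has a reduced expression ending in any alternating word
in `a`, `b` which is at most as long as the order of `cs.simple a * cs.simple b`. -/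
theorem exists_eq_mul_alternatingWord {g : G} {a b : ι} (ha : cs.IsRightDescent g a)
    (hb : cs.IsRightDescent g b) {n : ℕ}
    (hn : ∀ k, 0 < k → k < n → (cs.simple a * cs.simple b) ^ k ≠ 1) :
    ∃ y, g = y * cs.wordProd (alternatingWord a b n) ∧ cs.length y + n = cs.length g := by
  induction n generalizing a b with
  | zero => exact ⟨g, by simp [alternatingWord], rfl⟩
  | succ n ih =>
    have hn' : ∀ k, 0 < k → k < n + 1 → (cs.simple b * cs.simple a) ^ k ≠ 1 := by
      intro k hk hkn h
      refine hn k hk hkn ?_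
      rw [← inv_inj, ← inv_pow, mul_inv_rev, cs.inv_simple, cs.inv_simple, h, inv_one]
    obtain ⟨y, rfl, hy⟩ := ih hb ha fun k hk hkn ↦ hn' k hk (by omega)
    obtain ⟨ω, hω, rfl⟩ := cs.exists_isReduced y
    have hb' := hb
    rw [← cs.wordProd_append] at hb'
    rcases mem_rightInvSeq_append cs (simple_mem_rightInvSeq cs hb') with h | ⟨u, hu, h⟩
    · obtain ⟨k, hk, h⟩ := mem_rightInvSeq_alternatingWord cs h
      refine absurd ?_ (hn' (k + 1) (by omega) (by omega))
      rw [pow_succ', mul_assoc, ← h, cs.simple_mul_simple_self]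
    · obtain ⟨ω', hlen, hω'⟩ := exists_wordProd_mul_eq_of_mem_rightInvSeq cs hu
      have heq : cs.wordProd ω * cs.wordProd (alternatingWord b a n) =
          cs.wordProd ω' * cs.wordProd (alternatingWord a b (n + 1)) := by
        rw [alternatingWord_succ, cs.wordProd_concat, ← hω', h]
        simp only [mul_assoc, mul_inv_cancel_left]
        rw [← mul_assoc u, (cs.isReflection_of_mem_rightInvSeq ω hu).mul_self, one_mul]
      refine ⟨cs.wordProd ω', heq, ?_⟩
      have h1 := cs.length_mul_le (cs.wordProd ω') (cs.wordProd (alternatingWord a b (n + 1)))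
      have h2 := cs.length_wordProd_le ω'
      have h3 := cs.length_wordProd_le (alternatingWord a b (n + 1))
      rw [length_alternatingWord] at h3
      rw [← heq] at h1
      have := hω.eq
      omega

/-- The powers `x, x ^ 2, …, x ^ (n - 1)` are nontrivial. -/
def PowNontrivialBelow (n : ℕ) (x : G) : Prop := ∀ k, 0 < k → k < n → x ^ k ≠ 1

theorem powNontrivialBelow_two {x : G} (h : x ≠ 1) : PowNontrivialBelow 2 x := by
  intro k hk hk2
  obtain rfl : k = 1 := by omega
  simpa using h

theorem PowNontrivialBelow.succ {n : ℕ} {x : G} (h : PowNontrivialBelow n x) (hx : x ^ n ≠ 1) :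
    PowNontrivialBelow (n + 1) x := by
  intro k hk hkn
  rcases Nat.lt_succ_iff_lt_or_eq.1 hkn with h' | rfl
  · exact h k hk h'
  · exact hx

theorem PowNontrivialBelow.mono {m n : ℕ} {x : G} (h : PowNontrivialBelow n x) (hmn : m ≤ n) :
    PowNontrivialBelow m x :=
  fun k hk hkm ↦ h k hk (hkm.trans_le hmn)

theorem PowNontrivialBelow.simple_mul_comm {n : ℕ} {a b : ι}
    (h : PowNontrivialBelow n (cs.simple a * cs.simple b)) :
    PowNontrivialBelow n (cs.simple b * cs.simple a) := by
  intro k hk hkn h'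
  refine h k hk hkn ?_
  rw [← inv_inj, ← inv_pow, mul_inv_rev, cs.inv_simple, cs.inv_simple, h', inv_one]

variable {cs} {g : G} {a b : ι} 

theorem isRightDescent_mul (ha : cs.IsRightDescent g a) (hb : cs.IsRightDescent g b)
    (h : PowNontrivialBelow 2 (cs.simple a * cs.simple b)) :
    cs.IsRightDescent (g * cs.simple a) b := by
  obtain ⟨y, rfl, hy⟩ := exists_eq_mul_alternatingWord cs hb ha (h.simple_mul_comm cs)
  have h1 := cs.isRightDescent_iff.1 ha
  simp only [alternatingWord, List.concat_eq_append, List.nil_append, List.cons_append,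
    cs.wordProd_cons, cs.wordProd_nil, mul_one, ← mul_assoc,
    cs.simple_mul_simple_cancel_right] at h1 hy ⊢
  rw [CoxeterSystem.IsRightDescent, cs.simple_mul_simple_cancel_right]
  omega

theorem isRightDescent_mul_mul (ha : cs.IsRightDescent g a) (hb : cs.IsRightDescent g b)
    (h : PowNontrivialBelow 3 (cs.simple a * cs.simple b)) :
    cs.IsRightDescent (g * cs.simple a * cs.simple b) a := by
  obtain ⟨y, rfl, hy⟩ := exists_eq_mul_alternatingWord cs hb ha (h.simple_mul_comm cs)
  have h1 := cs.isRightDescent_iff.1 ha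
  have h2 := cs.isRightDescent_iff.1 (isRightDescent_mul ha hb (h.mono (by norm_num)))
  simp only [alternatingWord, List.concat_eq_append, List.nil_append, List.cons_append,
    cs.wordProd_cons, cs.wordProd_nil, mul_one, ← mul_assoc,
    cs.simple_mul_simple_cancel_right] at h1 h2 hy ⊢
  rw [CoxeterSystem.IsRightDescent, cs.simple_mul_simple_cancel_right]
  omega

theorem isRightDescent_mul_mul_mul (ha : cs.IsRightDescent g a) (hb : cs.IsRightDescent g b)
    (h : PowNontrivialBelow 4 (cs.simple a * cs.simple b)) :
    cs.IsRightDescent (g * cs.simple a * cs.simple b * cs.simple a) b := by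
  obtain ⟨y, rfl, hy⟩ := exists_eq_mul_alternatingWord cs hb ha (h.simple_mul_comm cs)
  have h1 := cs.isRightDescent_iff.1 ha
  have h2 := cs.isRightDescent_iff.1 (isRightDescent_mul ha hb (h.mono (by norm_num)))
  have h3 := cs.isRightDescent_iff.1 (isRightDescent_mul_mul ha hb (h.mono (by norm_num)))
  simp only [alternatingWord, List.concat_eq_append, List.nil_append, List.cons_append,
    cs.wordProd_cons, cs.wordProd_nil, mul_one, ← mul_assoc,
    cs.simple_mul_simple_cancel_right] at h1 h2 h3 hy ⊢
  rw [CoxeterSystem.IsRightDescent, cs.simple_mul_simple_cancel_right]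
  omega

/-- This pattern of descents reproduces itself at a shorter element, hence never occurs. -/
theorem false_of_descents {c : ι} {u : G} (hub : cs.IsRightDescent u b)
    (huc : cs.IsRightDescent u c) (huba : cs.IsRightDescent (u * cs.simple b) a)
    (hab : PowNontrivialBelow 4 (cs.simple a * cs.simple b))
    (hc : PowNontrivialBelow 3 (cs.simple a * cs.simple c) ∧
        PowNontrivialBelow 3 (cs.simple b * cs.simple c) ∨
      PowNontrivialBelow 2 (cs.simple a * cs.simple c) ∧
        PowNontrivialBelow 4 (cs.simple b * cs.simple c)) : False := by
  induction hn : cs.length u using Nat.strong_induction_on generalizing u a b with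
  | _ n ih =>
  subst hn
  have hba := hab.simple_mul_comm cs
  have hac : PowNontrivialBelow 2 (cs.simple a * cs.simple c) :=
    hc.elim (fun h ↦ h.1.mono (by norm_num)) (fun h ↦ h.1)
  have hbc : PowNontrivialBelow 3 (cs.simple b * cs.simple c) :=
    hc.elim (fun h ↦ h.2) (fun h ↦ h.2.mono (by norm_num))
  have hubc := isRightDescent_mul hub huc (hbc.mono (by norm_num))
  have hza := isRightDescent_mul hubc huba (hac.simple_mul_comm cs)
  have hzb := isRightDescent_mul_mul hub huc hbc
  have l1 : _ < _ := hub
  have l2 : _ < _ := hubc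
  rcases hc with ⟨hac3, -⟩ | ⟨-, hbc4⟩
  · have hzac := isRightDescent_mul_mul hubc huba (hac3.simple_mul_comm cs)
    have hzab := isRightDescent_mul hza hzb (hab.mono (by norm_num))
    have l3 : _ < _ := hza
    have l4 : _ < _ := hzab
    exact ih _ (by omega) (isRightDescent_mul_mul hza hzb (hab.mono (by norm_num)))
      (isRightDescent_mul hzab hzac (hbc.mono (by norm_num)))
      (isRightDescent_mul_mul_mul hza hzb hab) hba (Or.inl ⟨hbc, hac3⟩) rfl
  · have hzbc := isRightDescent_mul_mul_mul hub huc hbc4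
    have hzba := isRightDescent_mul hzb hza (hba.mono (by norm_num))
    have l3 : _ < _ := hzb
    have l4 : _ < _ := hzba
    exact ih _ (by omega) (isRightDescent_mul_mul hzb hza (hba.mono (by norm_num)))
      (isRightDescent_mul hzba hzbc hac)
      (isRightDescent_mul_mul_mul hzb hza hba) hab (Or.inr ⟨hac, hbc4⟩) rfl

theorem not_isRightDescent_mul_of_descents {c : ι} {f : G} (hfa : cs.IsRightDescent f a)
    (hfb : cs.IsRightDescent f b) (hab : PowNontrivialBelow 4 (cs.simple a * cs.simple b))
    (hac : PowNontrivialBelow 2 (cs.simple a * cs.simple c))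
    (hbc : PowNontrivialBelow 2 (cs.simple b * cs.simple c))
    (hc : PowNontrivialBelow 3 (cs.simple a * cs.simple c) ∧
        PowNontrivialBelow 3 (cs.simple b * cs.simple c) ∨
      PowNontrivialBelow 4 (cs.simple a * cs.simple c) ∨
      PowNontrivialBelow 4 (cs.simple b * cs.simple c)) :
    ¬ cs.IsRightDescent (f * cs.simple b) c := by
  intro hgc
  have hba := hab.simple_mul_comm cs
  have hga := isRightDescent_mul hfb hfa (hba.mono (by norm_num))
  have hub := isRightDescent_mul_mul hfb hfa (hba.mono (by norm_num))
  have huba := isRightDescent_mul_mul_mul hfb hfa hba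
  have huc := isRightDescent_mul hga hgc hac
  rcases hc with h | h | h
  · exact false_of_descents hub huc huba hab (Or.inl h)
  · have hya := isRightDescent_mul_mul hga hgc (h.mono (by norm_num))
    have hyb := isRightDescent_mul huc hub (hbc.simple_mul_comm cs)
    have hyac := isRightDescent_mul_mul_mul hga hgc h
    have hyab := isRightDescent_mul hya hyb (hab.mono (by norm_num))
    exact false_of_descents (isRightDescent_mul_mul hya hyb (hab.mono (by norm_num)))
      (isRightDescent_mul hyab hyac hbc) (isRightDescent_mul_mul_mul hya hyb hab) hba
      (Or.inr ⟨hbc, h⟩)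
  · exact false_of_descents hub huc huba hab (Or.inr ⟨hac, h⟩)

end Exchange

section FiniteSubgroups

variable {G : Type*} [Group G] {a b c : G}

theorem closure_subset_of_mul_mem {T X : Set G} (h1 : 1 ∈ X) (hT : ∀ t ∈ T, t * t = 1)
    (hmul : ∀ x ∈ X, ∀ t ∈ T, x * t ∈ X) : (Subgroup.closure T : Set G) ⊆ X := by
  intro g hg
  induction hg using Subgroup.closure_induction_right with
  | one => exact h1
  | mul_right x _ t ht ih => exact hmul x ih t ht
  | mul_inv_cancel x _ t ht ih =>
    rw [inv_eq_of_mul_eq_one_left (hT t ht)]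
    exact hmul x ih t ht

theorem mul_comm_of_sq_eq_one (ha : a * a = 1) (hb : b * b = 1) (h : (a * b) ^ 2 = 1) :
    b * a = a * b := by
  rw [pow_two] at h
  rw [eq_inv_of_mul_eq_one_left h, mul_inv_rev, inv_eq_of_mul_eq_one_left ha,
    inv_eq_of_mul_eq_one_left hb]

theorem braid_of_pow_three_eq_one (ha : a * a = 1) (hb : b * b = 1) (h : (a * b) ^ 3 = 1) :
    b * (a * b) = a * (b * a) := by
  have h' : a * (b * a) * (b * (a * b)) = 1 := by simpa [pow_succ, mul_assoc] using h
  rw [eq_inv_of_mul_eq_one_left h', mul_inv_rev, mul_inv_rev, inv_eq_of_mul_eq_one_left ha,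
    inv_eq_of_mul_eq_one_left hb, mul_assoc]

theorem braid_of_pow_four_eq_one (ha : a * a = 1) (hb : b * b = 1) (h : (a * b) ^ 4 = 1) :
    b * (a * (b * a)) = a * (b * (a * b)) := by
  have h' : a * (b * (a * b)) * (a * (b * (a * b))) = 1 := by
    simpa [pow_succ, mul_assoc] using h
  rw [eq_inv_of_mul_eq_one_left h']
  simp only [mul_inv_rev, inv_eq_of_mul_eq_one_left ha, inv_eq_of_mul_eq_one_left hb, mul_assoc]

theorem mem_closure_pair_of_pow_four_eq_one (ha : a * a = 1) (hb : b * b = 1)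
    (h : (a * b) ^ 4 = 1) {g : G} (hg : g ∈ Subgroup.closure {a, b}) :
    g ∈ ({1, a, b, a * b, b * a, a * (b * a), b * (a * b), a * (b * (a * b))} : Set G) := by
  have hab := braid_of_pow_four_eq_one ha hb h
  have ha' : ∀ x, a * (a * x) = x := fun x ↦ by rw [← mul_assoc, ha, one_mul]
  refine closure_subset_of_mul_mem (by simp) (by simp [ha, hb]) ?_ hg
  rintro x (rfl | rfl | rfl | rfl | rfl | rfl | rfl | rfl) t (rfl | rfl) <;>
    simp [mul_assoc, ha, hb, ha', hab]

theorem mem_closure_pair_of_pow_two_eq_one (ha : a * a = 1) (hb : b * b = 1)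
    (h : (a * b) ^ 2 = 1) {g : G} (hg : g ∈ Subgroup.closure {a, b}) :
    g ∈ ({1, a, b, a * b} : Set G) := by
  have hab := mul_comm_of_sq_eq_one ha hb h
  have ha' : ∀ x, a * (a * x) = x := fun x ↦ by rw [← mul_assoc, ha, one_mul]
  refine closure_subset_of_mul_mem (by simp) (by simp [ha, hb]) ?_ hg
  rintro x (rfl | rfl | rfl | rfl) t (rfl | rfl) <;>
    simp [mul_assoc, ha, hb, ha', hab]

/-- If right multiplication by `a`, `b`, `c` permutes the cosets `⟨a, b⟩ * r`, `r ∈ R`, for a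
finite set `R` containing `1`, then `⟨a, b, c⟩` is finite. -/
theorem finite_closure_of_cosets (ha : a * a = 1) (hb : b * b = 1) (hc : c * c = 1)
    (hab : (a * b) ^ 4 = 1) {R : Set G} (hR : R.Finite) (h1 : 1 ∈ R)
    (hmul : ∀ r ∈ R, ∀ t ∈ ({a, b, c} : Set G),
      ∃ d ∈ Subgroup.closure {a, b}, ∃ r' ∈ R, d * r' = r * t) :
    Finite (Subgroup.closure {a, b, c}) := by
  have hD : ((Subgroup.closure {a, b} : Subgroup G) : Set G).Finite :=
    Set.Finite.subset (Set.toFinite _) fun g hg ↦ mem_closure_pair_of_pow_four_eq_one ha hb hab hg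
  refine (Set.Finite.subset (hD.image2 (· * ·) hR)
    (closure_subset_of_mul_mem ⟨1, one_mem _, 1, h1, one_mul 1⟩
      (by simp [ha, hb, hc]) ?_)).to_subtype
  rintro _ ⟨d, hd, r, hr, rfl⟩ t ht
  obtain ⟨d', hd', r', hr', h⟩ := hmul r hr t ht
  exact ⟨d * d', mul_mem hd hd', r', hr', by simp only [mul_assoc, h]⟩

theorem finite_closure_of_commute (ha : a * a = 1) (hb : b * b = 1) (hc : c * c = 1)
    (hab : (a * b) ^ 4 = 1) (hac : (a * c) ^ 2 = 1) (hbc : (b * c) ^ 2 = 1) :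
    Finite (Subgroup.closure {a, b, c}) := by
  have hac := mul_comm_of_sq_eq_one ha hc hac
  have hbc := mul_comm_of_sq_eq_one hb hc hbc
  have haD : a ∈ Subgroup.closure {a, b} := Subgroup.subset_closure (by simp)
  have hbD : b ∈ Subgroup.closure {a, b} := Subgroup.subset_closure (by simp)
  refine finite_closure_of_cosets ha hb hc hab (R := {1, c}) (Set.toFinite _) (by simp) ?_
  rintro r (rfl | rfl) t (rfl | rfl | rfl)
  · exact ⟨_, haD, 1, by simp⟩
  · exact ⟨_, hbD, 1, by simp⟩
  · exact ⟨1, one_mem _, t, by simp⟩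
  · exact ⟨_, haD, r, by simp [hac]⟩
  · exact ⟨_, hbD, r, by simp [hbc]⟩
  · exact ⟨1, one_mem _, 1, by simp [hc]⟩

theorem finite_closure_of_braid (ha : a * a = 1) (hb : b * b = 1) (hc : c * c = 1)
    (hab : (a * b) ^ 4 = 1) (hac : (a * c) ^ 2 = 1) (hbc : (b * c) ^ 3 = 1) :
    Finite (Subgroup.closure {a, b, c}) := by
  have hab' := braid_of_pow_four_eq_one ha hb hab
  have hac := mul_comm_of_sq_eq_one ha hc hac
  have hbc := braid_of_pow_three_eq_one hb hc hbc
  have hac' : ∀ x, c * (a * x) = a * (c * x) := fun x ↦ by rw [← mul_assoc, hac, mul_assoc]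
  have hbc' : ∀ x, c * (b * (c * x)) = b * (c * (b * x)) := fun x ↦ by
    simpa only [mul_assoc] using congrArg (· * x) hbc
  have hab'' : ∀ x, b * (a * (b * (a * x))) = a * (b * (a * (b * x))) := fun x ↦ by
    simpa only [mul_assoc] using congrArg (· * x) hab'
  have haD : a ∈ Subgroup.closure {a, b} := Subgroup.subset_closure (by simp)
  have hbD : b ∈ Subgroup.closure {a, b} := Subgroup.subset_closure (by simp)
  have h1D : (1 : G) ∈ Subgroup.closure {a, b} := one_mem _
  refine finite_closure_of_cosets ha hb hc hab
    (R := {1, c, c * b, c * (b * a), c * (b * (a * b)), c * (b * (a * (b * c)))})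
    (Set.toFinite _) (by simp) ?_
  rintro r hr t ht
  simp only [Set.mem_insert_iff, Set.mem_singleton_iff] at hr ht
  rcases hr with rfl | rfl | rfl | rfl | rfl | rfl
  · rcases ht with rfl | rfl | rfl
    · exact ⟨_, haD, 1, by simp⟩
    · exact ⟨_, hbD, 1, by simp⟩
    · exact ⟨1, h1D, t, by simp⟩
  · rcases ht with rfl | rfl | rfl
    · exact ⟨_, haD, r, by simp [hac]⟩
    · exact ⟨1, h1D, r * t, by simp⟩
    · exact ⟨1, h1D, 1, by simp [hc]⟩
  · rcases ht with rfl | rfl | rfl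
    · exact ⟨1, h1D, c * (b * t), by simp [mul_assoc]⟩
    · exact ⟨1, h1D, c, by simp [mul_assoc, hb]⟩
    · exact ⟨b, hbD, t * b, by simp [mul_assoc, hbc]⟩
  · rcases ht with rfl | rfl | rfl
    · exact ⟨1, h1D, c * b, by simp [mul_assoc, ha]⟩
    · exact ⟨1, h1D, c * (t * (a * t)), by simp [mul_assoc]⟩
    · exact ⟨b, hbD, t * (b * a), by simp, by simp only [mul_assoc, ← hac, hbc']⟩
  · rcases ht with rfl | rfl | rfl
    · exact ⟨t, haD, c * (b * (t * b)), by simp, by simp only [mul_assoc, hab', hac']⟩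
    · exact ⟨1, h1D, c * (t * a), by simp [mul_assoc, hb]⟩
    · exact ⟨1, h1D, t * (b * (a * (b * t))), by simp [mul_assoc]⟩
  · rcases ht with rfl | rfl | rfl
    · exact ⟨t, haD, c * (b * (t * (b * c))), by simp,
        by simp only [mul_assoc, hac, hab'', hac']⟩
    · exact ⟨t, hbD, c * (t * (a * (t * c))), by simp,
        by simp only [mul_assoc, ← hbc, ← hac', hbc']⟩
    · exact ⟨1, h1D, t * (b * (a * b)), by simp [mul_assoc, hc]⟩

end FiniteSubgroups

section LongestElement

variable {ι G : Type} [Group G] {N : CoxeterMatrix ι}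

theorem simple_mul_simple_ne_one {cs : CoxeterSystem N G} {g : G} {a b : ι}
    (ha : cs.IsRightDescent g a) (hb : ¬ cs.IsRightDescent g b) : cs.simple a * cs.simple b ≠ 1 := by
  intro h
  rw [mul_eq_one_iff_eq_inv, cs.inv_simple] at h
  exact hb (by rwa [CoxeterSystem.IsRightDescent, h] at ha)

theorem wg_mem (cs : CoxeterSystem N G) (g : G) : wg cs g ∈ descSubgroup cs g := by
  rw [wg]
  split_ifs with h
  · exact h.choose_spec.1
  · exact one_mem _

theorem length_le_length_wg (cs : CoxeterSystem N G) {g u : G} (hu : u ∈ descSubgroup cs g)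
    {n : ℕ} (hn : ∀ v ∈ descSubgroup cs g, cs.length v ≤ n) (hun : cs.length u = n) :
    n ≤ cs.length (wg cs g) := by
  have h : ∃ w₀ ∈ descSubgroup cs g, ∀ u ∈ descSubgroup cs g, cs.length u ≤ cs.length w₀ :=
    ⟨u, hu, fun v hv ↦ hun ▸ hn v hv⟩
  rw [wg, dif_pos h, ← hun]
  exact h.choose_spec.2 u hu

theorem length_le_two_of_mem_closure_pair (cs : CoxeterSystem N G) {i j : ι}
    (hij : (cs.simple i * cs.simple j) ^ 2 = 1) {g : G}
    (hg : g ∈ Subgroup.closure {cs.simple i, cs.simple j}) : cs.length g ≤ 2 := by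
  have hle := cs.length_wordProd_le
  rcases mem_closure_pair_of_pow_two_eq_one (cs.simple_mul_simple_self i)
    (cs.simple_mul_simple_self j) hij hg with rfl | rfl | rfl | rfl
  · simp
  · simp
  · simp
  · simpa [cs.wordProd_cons] using hle [i, j]

theorem wg_eq_of_pow_four (cs : CoxeterSystem N G) {f : G} {i j : ι}
    (hTf : descentSet cs f = {i, j})
    (hij : PowNontrivialBelow 4 (cs.simple i * cs.simple j))
    (hst : (cs.simple i * cs.simple j) ^ 4 = 1) :
    wg cs f = cs.simple i * (cs.simple j * (cs.simple i * cs.simple j)) := by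
  have hD : descSubgroup cs f = Subgroup.closure {cs.simple i, cs.simple j} := by
    rw [descSubgroup, hTf, Set.image_pair]
  have hfi : cs.IsRightDescent f i := by
    change i ∈ descentSet cs f
    simp [hTf]
  have hfj : cs.IsRightDescent f j := by
    change j ∈ descentSet cs f
    simp [hTf]
  have hle := cs.length_wordProd_le
  have hmem : ∀ v ∈ descSubgroup cs f,
      cs.length v ≤ 3 ∨ v = cs.simple i * (cs.simple j * (cs.simple i * cs.simple j)) := by
    intro v hv
    rw [hD] at hv
    rcases mem_closure_pair_of_pow_four_eq_one (cs.simple_mul_simple_self i)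
      (cs.simple_mul_simple_self j) hst hv with rfl | rfl | rfl | rfl | rfl | rfl | rfl | rfl
    · simp
    · simp
    · simp
    · exact Or.inl ((by simpa [cs.wordProd_cons] using hle [i, j] : _ ≤ 2).trans (by norm_num))
    · exact Or.inl ((by simpa [cs.wordProd_cons] using hle [j, i] : _ ≤ 2).trans (by norm_num))
    · exact Or.inl (by simpa [cs.wordProd_cons] using hle [i, j, i])
    · exact Or.inl (by simpa [cs.wordProd_cons] using hle [j, i, j])
    · exact Or.inr rfl
  have hlong : cs.length (cs.simple i * (cs.simple j * (cs.simple i * cs.simple j))) = 4 := by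
    obtain ⟨y, hy, hlen⟩ := exists_eq_mul_alternatingWord cs hfi hfj hij
    have h := cs.length_mul_le y (cs.wordProd (alternatingWord i j 4))
    rw [← hy, ← hlen] at h
    have h' := cs.length_wordProd_le (alternatingWord i j 4)
    rw [length_alternatingWord] at h'
    simp only [alternatingWord, List.concat_eq_append, List.nil_append, List.cons_append,
      cs.wordProd_cons, cs.wordProd_nil, mul_one] at h h'
    omega
  have hmax : 4 ≤ cs.length (wg cs f) := by
    refine length_le_length_wg cs
      (u := cs.simple i * (cs.simple j * (cs.simple i * cs.simple j))) ?_ ?_ hlong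
    · have hi : cs.simple i ∈ descSubgroup cs f := hD ▸ Subgroup.subset_closure (by simp)
      have hj : cs.simple j ∈ descSubgroup cs f := hD ▸ Subgroup.subset_closure (by simp)
      exact mul_mem hi (mul_mem hj (mul_mem hi hj))
    · intro v hv
      rcases hmem v hv with h | rfl
      · omega
      · exact hlong.le
  rcases hmem _ (wg_mem cs f) with h | h
  · omega
  · exact h

end LongestElement

theorem TwoDimensional.powNontrivialBelow {ι G : Type} [Group G] {N : CoxeterMatrix ι}
    {cs : CoxeterSystem N G} (h2 : TwoDimensional cs)
    {i j k : ι} (hij : i ≠ j) (hik : i ≠ k) (hjk : j ≠ k)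
    (hst : (cs.simple i * cs.simple j) ^ 4 = 1)
    (h1 : PowNontrivialBelow 2 (cs.simple i * cs.simple k))
    (h1' : PowNontrivialBelow 2 (cs.simple j * cs.simple k)) :
    PowNontrivialBelow 3 (cs.simple i * cs.simple k) ∧
        PowNontrivialBelow 3 (cs.simple j * cs.simple k) ∨
      PowNontrivialBelow 4 (cs.simple i * cs.simple k) ∨
      PowNontrivialBelow 4 (cs.simple j * cs.simple k) := by
  have hinf := h2 i j k hij hik hjk
  have hi := cs.simple_mul_simple_self i
  have hj := cs.simple_mul_simple_self j
  have hk := cs.simple_mul_simple_self k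
  have hst' : (cs.simple j * cs.simple i) ^ 4 = 1 := by
    rw [← inv_inj, ← inv_pow, mul_inv_rev, cs.inv_simple, cs.inv_simple, hst, inv_one]
  by_cases hp : (cs.simple i * cs.simple k) ^ 2 = 1
  · by_cases hq : (cs.simple j * cs.simple k) ^ 2 = 1
    · exact absurd (finite_closure_of_commute hi hj hk hst hp hq) hinf.not_finite
    · by_cases hq' : (cs.simple j * cs.simple k) ^ 3 = 1
      · exact absurd (finite_closure_of_braid hi hj hk hst hp hq') hinf.not_finite
      · exact Or.inr (Or.inr ((h1'.succ hq).succ hq'))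
  · by_cases hq : (cs.simple j * cs.simple k) ^ 2 = 1
    · by_cases hp' : (cs.simple i * cs.simple k) ^ 3 = 1
      · rw [Set.insert_comm] at hinf
        exact absurd (finite_closure_of_braid hj hi hk hst' hq hp') hinf.not_finite
      · exact Or.inr (Or.inl ((h1.succ hp).succ hp'))
    · exact Or.inl ⟨h1.succ hp, h1'.succ hq⟩

/-- **Corollary (iv).** If `m_st = 4`, then `m ≤ 2`. -/
theorem corollary_step1_iv
    (cs : CoxeterSystem M W) (h2 : TwoDimensional cs)
    (f : W) (i j : B) (hij : i ≠ j) (hTf : descentSet cs f = {i, j})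
    (g : W) (hgR : f⁻¹ * g ∈ Subgroup.closure {cs.simple i, cs.simple j})
    (k : B) (hki : k ≠ i) (hkj : k ≠ j) (hTg : descentSet cs g = {i, k})
    (hst : M.M i j = 4) :
    cs.length ((PiMap cs f)⁻¹ * g) ≤ 2 := by
  have hfi : cs.IsRightDescent f i := by
    change i ∈ descentSet cs f
    simp [hTf]
  have hfj : cs.IsRightDescent f j := by
    change j ∈ descentSet cs f
    simp [hTf]
  have hfk : ¬ cs.IsRightDescent f k := by
    change k ∉ descentSet cs f
    simp [hTf, hki, hkj]
  have hgi : cs.IsRightDescent g i := by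
    change i ∈ descentSet cs g
    simp [hTg]
  have hgk : cs.IsRightDescent g k := by
    change k ∈ descentSet cs g
    simp [hTg]
  have hgj : ¬ cs.IsRightDescent g j := by
    change j ∉ descentSet cs g
    simp [hTg, hij.symm, hkj.symm]
  have hij2 := powNontrivialBelow_two (simple_mul_simple_ne_one hgi hgj)
  have hst4 : (cs.simple i * cs.simple j) ^ 4 = 1 := hst ▸ cs.simple_mul_simple_pow i j
  have hmem : (PiMap cs f)⁻¹ * g = (wg cs f)⁻¹ * (f⁻¹ * g) := by
    rw [PiMap, mul_inv_rev, mul_assoc]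
  rw [hmem]
  by_cases hsq : (cs.simple i * cs.simple j) ^ 2 = 1
  · have hw := wg_mem cs f
    rw [descSubgroup, hTf, Set.image_pair] at hw
    exact length_le_two_of_mem_closure_pair cs hsq (mul_mem (inv_mem hw) hgR)
  have hij4 : PowNontrivialBelow 4 (cs.simple i * cs.simple j) := by
    refine (hij2.succ hsq).succ fun hcube ↦ ?_
    rw [pow_succ, hcube, one_mul] at hst4
    exact simple_mul_simple_ne_one hgi hgj hst4
  have hle := cs.length_wordProd_le
  obtain ⟨v, rfl⟩ : ∃ v, g = f * v := ⟨f⁻¹ * g, by simp⟩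
  rw [inv_mul_cancel_left] at hgR ⊢
  rw [wg_eq_of_pow_four cs hTf hij4 hst4]
  have hw : (cs.simple i * (cs.simple j * (cs.simple i * cs.simple j)))⁻¹ =
      cs.simple i * (cs.simple j * (cs.simple i * cs.simple j)) := by
    rw [inv_eq_iff_mul_eq_one, ← hst4]
    simp only [pow_succ, pow_zero, one_mul, mul_assoc]
  have hbraid := braid_of_pow_four_eq_one (cs.simple_mul_simple_self i)
    (cs.simple_mul_simple_self j) hst4
  rw [hw]
  rcases mem_closure_pair_of_pow_four_eq_one (cs.simple_mul_simple_self i)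
    (cs.simple_mul_simple_self j) hst4 hgR with rfl | rfl | rfl | rfl | rfl | rfl | rfl | rfl
  · exact absurd (by simpa using hgk) hfk
  · exact absurd (isRightDescent_mul hfi hfj hij2) hgj
  · exact absurd hgk (not_isRightDescent_mul_of_descents hfi hfj hij4
      (powNontrivialBelow_two (simple_mul_simple_ne_one hfi hfk))
      (powNontrivialBelow_two (simple_mul_simple_ne_one hfj hfk))
      (h2.powNontrivialBelow hij hki.symm hkj.symm hst4
        (powNontrivialBelow_two (simple_mul_simple_ne_one hfi hfk))
        (powNontrivialBelow_two (simple_mul_simple_ne_one hfj hfk))))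
  · rw [← hbraid]
    simpa [mul_assoc, cs.wordProd_cons] using hle [j, i]
  · simpa [mul_assoc, cs.wordProd_cons] using hle [i, j]
  · rw [← hbraid]
    simp [mul_assoc]
  · simp [mul_assoc]
  · rw [inv_eq_iff_mul_eq_one.1 hw]
    simp

end CoxeterPaper
end
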